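/- Let p ∈ ℂ[z_1,…,z_d] be a polynomial. Then ‖p(T)‖ ≤ 1 for every d-tuple T = (T_1,…,T_d) of pairwise commuting contractive bounded operators on a complex Hilbert space if and only if ‖p(M)‖ ≤ 1 for every d-tuple M = (M_1,…,M_d) of pairwise commuting contractive nilpotent complex square matrices (of arbitrary finite size). -/

import Mathlib

open scoped ComplexConjugate ComplexOrder

/-- The operator (spectral) norm of a complex matrix, i.e. the norm of the induced
operator on Euclidean space. -/
noncomputable def matOpNorm {ι : Type*} [Fintype ι] (M : Matrix ι ι ℂ) : ℝ :=
  letI := Classical.decEq ι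
  ‖Matrix.toEuclideanCLM (𝕜 := ℂ) M‖

/-- Evaluation `p(T) = ∑_α p_α T^α` of a polynomial `p ∈ ℂ[z_1,…,z_d]` on a
`d`-tuple of elements of a `ℂ`-algebra, where `T^α = T_1^{α_1} ⋯ T_d^{α_d}`. -/
noncomputable def polyEval {d : ℕ} (p : MvPolynomial (Fin d) ℂ)
    {A : Type*} [Ring A] [Algebra ℂ A] (T : Fin d → A) : A :=
  ∑ α ∈ p.support, p.coeff α • (List.ofFn fun j => T j ^ α j).prod

/-- The `j`-th standard unit multi-index `e_j`. -/
def eVec {d : ℕ} (j : Fin d) : Fin d → ℕ := fun i => if i = j then 1 else 0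

/-- A simple `N`-nilpotent `d`-tuple: pairwise commuting `n × n` matrices together with a
spanning set `{b_α : |α| ≤ N}` of `ℂ^n` such that `T_j b_α = b_{α+e_j}` when `|α| ≤ N-1`
and `T_j b_α = 0` when `|α| = N`. -/
def IsSimpleNilTuple (d N n : ℕ) (T : Fin d → Matrix (Fin n) (Fin n) ℂ) : Prop :=
  (∀ i j, Commute (T i) (T j)) ∧
  ∃ b : (Fin d → ℕ) → (Fin n → ℂ),
    Submodule.span ℂ {v | ∃ α : Fin d → ℕ, (∑ i, α i) ≤ N ∧ v = b α} = ⊤ ∧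
    (∀ (j : Fin d) (α : Fin d → ℕ), (∑ i, α i) < N → (T j).mulVec (b α) = b (α + eVec j)) ∧
    (∀ (j : Fin d) (α : Fin d → ℕ), (∑ i, α i) = N → (T j).mulVec (b α) = 0)

theorem polyEval_map {d : ℕ} (p : MvPolynomial (Fin d) ℂ) {A B : Type*} [Ring A] [Algebra ℂ A]
    [Ring B] [Algebra ℂ B] (φ : A →ₐ[ℂ] B) (T : Fin d → A) :
    φ (polyEval p T) = polyEval p (fun j => φ (T j)) := by
  simp only [polyEval, map_sum, map_smul, map_list_prod, List.map_ofFn]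
  simp [Function.comp_def]

theorem intertwine_list {V W ι : Type*} [AddCommGroup V] [Module ℂ V] [AddCommGroup W] [Module ℂ W]
    (J : V →ₗ[ℂ] W) (B : ι → Module.End ℂ V) (A : ι → Module.End ℂ W)
    (h : ∀ j x, J (B j x) = A j (J x)) (l : List ι) (x : V) :
    J ((l.map B).prod x) = (l.map A).prod (J x) := by
  induction l generalizing x with
  | nil => simp
  | cons a l ih => simp [h, ih]

theorem intertwine_pow {V W : Type*} [AddCommGroup V] [Module ℂ V] [AddCommGroup W] [Module ℂ W]
    (J : V →ₗ[ℂ] W) (B : Module.End ℂ V) (A : Module.End ℂ W)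
    (h : ∀ x, J (B x) = A (J x)) (k : ℕ) (x : V) :
    J ((B ^ k) x) = (A ^ k) (J x) := by
  induction k generalizing x with
  | zero => simp
  | succ k ih => simp [pow_succ, h, ih]

theorem polyEval_intertwine {d : ℕ} (p : MvPolynomial (Fin d) ℂ)
    {V W : Type*} [AddCommGroup V] [Module ℂ V] [AddCommGroup W] [Module ℂ W]
    (J : V →ₗ[ℂ] W) (B : Fin d → Module.End ℂ V) (A : Fin d → Module.End ℂ W)
    (h : ∀ j x, J (B j x) = A j (J x)) (x : V) :
    J (polyEval p B x) = polyEval p A (J x) := by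
  simp only [polyEval, LinearMap.sum_apply, LinearMap.smul_apply, map_sum, map_smul]
  refine Finset.sum_congr rfl fun α _ => ?_
  congr 1
  rw [List.ofFn_eq_map, List.ofFn_eq_map]
  exact intertwine_list J _ _ (fun j x => intertwine_pow J _ _ (h j) _ x) _ x

/-- The inclusion of bounded operators into linear endomorphisms. -/
def clmToEnd (H : Type*) [NormedAddCommGroup H] [InnerProductSpace ℂ H] :
    (H →L[ℂ] H) →ₐ[ℂ] Module.End ℂ H where
  toFun S := S
  map_one' := rfl
  map_mul' _ _ := rfl
  map_zero' := rfl
  map_add' _ _ := rfl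
  commutes' _ := rfl

theorem polyEval_clm {d : ℕ} (p : MvPolynomial (Fin d) ℂ) {H : Type*} [NormedAddCommGroup H]
    [InnerProductSpace ℂ H] (T : Fin d → H →L[ℂ] H) (x : H) :
    polyEval p T x = polyEval p (fun j => (T j : Module.End ℂ H)) x :=
  LinearMap.congr_fun
    (polyEval_map p (clmToEnd H) T) x

theorem matOpNorm_eq {n : ℕ} (M : Matrix (Fin n) (Fin n) ℂ) :
    matOpNorm M = ‖Matrix.toEuclideanCLM (𝕜 := ℂ) M‖ := by
  unfold matOpNorm
  congr!

theorem toCLM_polyEval {d n : ℕ} (p : MvPolynomial (Fin d) ℂ)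
    (M : Fin d → Matrix (Fin n) (Fin n) ℂ) :
    Matrix.toEuclideanCLM (𝕜 := ℂ) (polyEval p M) =
      polyEval p (fun j => Matrix.toEuclideanCLM (𝕜 := ℂ) (M j)) :=
  polyEval_map p (Matrix.toEuclideanCLM (𝕜 := ℂ) (n := Fin n)).toAlgEquiv.toAlgHom M

/-- The right-hand side of the equivalence, in terms of operators on Euclidean space. -/
theorem nil_clm {d : ℕ} (p : MvPolynomial (Fin d) ℂ)
    (hp : ∀ (n : ℕ) (M : Fin d → Matrix (Fin n) (Fin n) ℂ),
        (∀ i j, Commute (M i) (M j)) → (∀ j, IsNilpotent (M j)) →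
        (∀ j, matOpNorm (M j) ≤ 1) → matOpNorm (polyEval p M) ≤ 1)
    (n : ℕ) (C : Fin d → EuclideanSpace ℂ (Fin n) →L[ℂ] EuclideanSpace ℂ (Fin n))
    (hc : ∀ i j, Commute (C i) (C j)) (hn : ∀ j, IsNilpotent (C j)) (h1 : ∀ j, ‖C j‖ ≤ 1) :
    ‖polyEval p C‖ ≤ 1 := by
  let φ := (Matrix.toEuclideanCLM (𝕜 := ℂ) (n := Fin n))
  have := hp n (fun j => φ.symm (C j)) (fun i j => (hc i j).map φ.symm)
    (fun j => (hn j).map φ.symm) (fun j => by rw [matOpNorm_eq]; simpa [φ] using h1 j)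
  rw [matOpNorm_eq, toCLM_polyEval] at this
  simpa [φ] using this

theorem exists_invariant {ι E : Type*} [AddCommGroup E] [Module ℂ E] (A : ι → Module.End ℂ E)
    (hc : ∀ i j, Commute (A i) (A j)) (hn : ∀ j, IsNilpotent (A j)) (v : E) (s : Finset ι) :
    ∃ V : Submodule ℂ E, FiniteDimensional ℂ V ∧ v ∈ V ∧ ∀ j ∈ s, ∀ x ∈ V, A j x ∈ V := by
  classical
  induction s using Finset.induction_on with
  | empty => exact ⟨ℂ ∙ v, inferInstance, Submodule.mem_span_singleton_self v, by simp⟩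
  | insert k s _ ih =>
    obtain ⟨V, hV, hv, hinv⟩ := ih
    obtain ⟨N, hN⟩ := hn k
    have hmem : ∀ (i : ℕ), ∀ x ∈ V, (A k ^ i) x ∈ ⨆ i : Fin (N+1), V.map (A k ^ (i : ℕ)) := by
      intro i x hx
      by_cases hi : i < N + 1
      · exact Submodule.mem_iSup_of_mem (⟨i, hi⟩ : Fin (N+1)) (Submodule.mem_map_of_mem hx)
      · rw [pow_eq_zero_of_le (by omega) hN]; simp
    refine ⟨⨆ i : Fin (N+1), V.map (A k ^ (i : ℕ)), inferInstance, ?_, ?_⟩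
    · simpa using hmem 0 v hv
    · intro j hj x hx
      suffices h : (⨆ i : Fin (N+1), V.map (A k ^ (i : ℕ))) ≤
          (⨆ i : Fin (N+1), V.map (A k ^ (i : ℕ))).comap (A j) from h hx
      refine iSup_le fun i => ?_
      rintro _ ⟨y, hy, rfl⟩
      rw [Submodule.mem_comap]
      rcases Finset.mem_insert.1 hj with rfl | hj
      · have := hmem (i + 1) y hy
        rwa [pow_succ'] at this
      · have := hmem i (A j y) (hinv j hj y hy)
        rw [← Module.End.mul_apply, ← ((hc j k).pow_right i).eq] at this
        exact this

theorem nil_end {d : ℕ} (p : MvPolynomial (Fin d) ℂ)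
    (hp : ∀ (n : ℕ) (M : Fin d → Matrix (Fin n) (Fin n) ℂ),
        (∀ i j, Commute (M i) (M j)) → (∀ j, IsNilpotent (M j)) →
        (∀ j, matOpNorm (M j) ≤ 1) → matOpNorm (polyEval p M) ≤ 1)
    {E : Type*} [NormedAddCommGroup E] [InnerProductSpace ℂ E] (A : Fin d → Module.End ℂ E)
    (hc : ∀ i j, Commute (A i) (A j)) (hn : ∀ j, IsNilpotent (A j))
    (h1 : ∀ j x, ‖A j x‖ ≤ ‖x‖) (v : E) :
    ‖polyEval p A v‖ ≤ ‖v‖ := by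
  obtain ⟨V, hV, hv, hinv⟩ := exists_invariant A hc hn v Finset.univ
  let e := (stdOrthonormalBasis ℂ V).repr
  let J : EuclideanSpace ℂ (Fin (Module.finrank ℂ V)) →ₗᵢ[ℂ] E :=
    V.subtypeₗᵢ.comp e.symm.toLinearIsometry
  let C : Fin d → EuclideanSpace ℂ (Fin (Module.finrank ℂ V)) →L[ℂ]
      EuclideanSpace ℂ (Fin (Module.finrank ℂ V)) := fun j =>
    LinearMap.toContinuousLinearMap
      (e.toLinearEquiv.toLinearMap ∘ₗ (A j).restrict (hinv j (Finset.mem_univ j)) ∘ₗ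
        e.symm.toLinearEquiv.toLinearMap)
  have hJ : ∀ j x, J (C j x) = A j (J x) := by
    intro j x
    simp [J, C]
  have hinj : Function.Injective J := J.injective
  have hpow : ∀ j k x, J ((C j ^ k) x) = (A j ^ k) (J x) := by
    intro j k x
    induction k generalizing x with
    | zero => simp
    | succ k ih =>
      rw [pow_succ, pow_succ]
      exact (ih (C j x)).trans (congrArg _ (hJ j x))
  have key := nil_clm p hp _ C ?_ ?_ ?_
  · have hvJ : J (e ⟨v, hv⟩) = v := by simp [J]
    have h2 := polyEval_intertwine p J.toLinearMap (fun j => (C j : Module.End ℂ _)) A hJ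
      (e ⟨v, hv⟩)
    rw [← polyEval_clm] at h2
    simp only [LinearIsometry.coe_toLinearMap, hvJ] at h2
    rw [← h2, J.norm_map]
    calc _ ≤ 1 * ‖e ⟨v, hv⟩‖ := ContinuousLinearMap.le_of_opNorm_le _ key _
      _ = ‖v‖ := by simp
  · intro i j
    ext1 x
    apply hinj
    have := LinearMap.congr_fun (hc i j).eq (J x)
    simpa [hJ] using this
  · intro j
    obtain ⟨N, hN⟩ := hn j
    refine ⟨N, ?_⟩
    ext1 x
    apply hinj
    rw [hpow, hN]
    simp
  · intro j
    refine ContinuousLinearMap.opNorm_le_bound _ zero_le_one fun x => ?_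
    rw [← J.norm_map, hJ, one_mul, ← J.norm_map x]
    exact h1 _ _

section shift
variable {H : Type*} [NormedAddCommGroup H] [InnerProductSpace ℂ H]

/-- Tensor product of `T` with the truncated shift. -/
noncomputable def tshift (K : ℕ) (T : H →L[ℂ] H) :
    Module.End ℂ (PiLp 2 (fun _ : Fin (K+1) => H)) where
  toFun y := WithLp.toLp 2 (Fin.cons 0 (fun i : Fin K => T (y i.castSucc)))
  map_add' x y := by
    ext m
    refine Fin.cases ?_ (fun i => ?_) m <;> simp
  map_smul' c y := by
    ext m
    refine Fin.cases ?_ (fun i => ?_) m <;> simp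

@[simp] theorem tshift_zero (K : ℕ) (T : H →L[ℂ] H) (y : PiLp 2 (fun _ : Fin (K+1) => H)) :
    tshift K T y 0 = 0 := rfl

@[simp] theorem tshift_succ (K : ℕ) (T : H →L[ℂ] H) (y : PiLp 2 (fun _ : Fin (K+1) => H))
    (i : Fin K) : tshift K T y i.succ = T (y i.castSucc) := rfl

theorem tshift_comm (K : ℕ) (S T : H →L[ℂ] H) (h : Commute S T) :
    Commute (tshift K S) (tshift K T) := by
  refine LinearMap.ext fun y => ?_
  ext m
  refine Fin.cases (by simp) (fun i => ?_) m
  simp only [Module.End.mul_apply, tshift_succ]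
  cases K with
  | zero => exact i.elim0
  | succ K =>
    refine Fin.cases ?_ (fun i => ?_) i
    · simp
    · rw [← Fin.succ_castSucc, tshift_succ, tshift_succ]
      exact congrArg (fun f : H →L[ℂ] H => f _) h.eq

theorem tshift_norm (K : ℕ) (T : H →L[ℂ] H) (h : ‖T‖ ≤ 1)
    (y : PiLp 2 (fun _ : Fin (K+1) => H)) : ‖tshift K T y‖ ≤ ‖y‖ := by
  refine le_of_sq_le_sq ?_ (norm_nonneg _)
  rw [PiLp.norm_sq_eq_of_L2, PiLp.norm_sq_eq_of_L2, Fin.sum_univ_succ, Fin.sum_univ_castSucc]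
  simp only [tshift_zero, tshift_succ, norm_zero]
  have : ∑ i : Fin K, ‖T (y i.castSucc)‖ ^ 2 ≤ ∑ i : Fin K, ‖y i.castSucc‖ ^ 2 := by
    refine Finset.sum_le_sum fun i _ => ?_
    have := T.le_of_opNorm_le h (y i.castSucc)
    gcongr
    simpa using this
  nlinarith [sq_nonneg ‖y (Fin.last K)‖]

theorem tshift_nil (K : ℕ) (T : H →L[ℂ] H) : IsNilpotent (tshift K T) := by
  have : ∀ k : ℕ, ∀ y : PiLp 2 (fun _ : Fin (K+1) => H), ∀ m : Fin (K+1), (m : ℕ) < k →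
      (tshift K T ^ k) y m = 0 := by
    intro k
    induction k with
    | zero => intro y m hm; omega
    | succ k ih =>
      intro y m
      rw [pow_succ', Module.End.mul_apply]
      refine Fin.cases (by simp) (fun i hi => ?_) m
      rw [tshift_succ, ih y i.castSucc (by simpa using hi), map_zero]
  refine ⟨K+1, LinearMap.ext fun y => ?_⟩
  ext m
  exact this _ y m m.2

/-- `y` is eventually (from index `m0` on) equal to `x`. -/
def EvConst {K : ℕ} (m0 : ℕ) (y : PiLp 2 (fun _ : Fin (K+1) => H)) (x : H) : Prop :=
  ∀ m : Fin (K+1), m0 ≤ (m : ℕ) → y m = x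

theorem EvConst.shift {K m0 : ℕ} {y : PiLp 2 (fun _ : Fin (K+1) => H)} {x : H}
    (h : EvConst m0 y x) (T : H →L[ℂ] H) : EvConst (m0 + 1) (tshift K T y) (T x) := by
  intro m
  refine Fin.cases (fun h0 => by simp at h0) (fun i hi => ?_) m
  rw [tshift_succ, h i.castSucc (by simpa using hi)]

theorem EvConst.pow {K m0 : ℕ} {y : PiLp 2 (fun _ : Fin (K+1) => H)} {x : H}
    (h : EvConst m0 y x) (T : H →L[ℂ] H) (k : ℕ) :
    EvConst (m0 + k) ((tshift K T ^ k) y) ((T ^ k) x) := by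
  induction k with
  | zero => simpa using h
  | succ k ih =>
    rw [pow_succ', pow_succ']
    exact ih.shift T

theorem EvConst.list {K m0 d : ℕ} {y : PiLp 2 (fun _ : Fin (K+1) => H)} {x : H}
    (h : EvConst m0 y x) (T : Fin d → H →L[ℂ] H) (α : Fin d → ℕ) (l : List (Fin d)) :
    EvConst (m0 + (l.map α).sum) ((l.map fun j => tshift K (T j) ^ α j).prod y)
      ((l.map fun j => T j ^ α j).prod x) := by
  induction l with
  | nil => simpa using h
  | cons a l ih =>
    have := ih.pow (T a) (α a)
    rw [List.map_cons, List.map_cons, List.map_cons, List.prod_cons, List.prod_cons,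
      List.sum_cons, add_comm (α a), ← add_assoc]
    exact this

theorem EvConst.poly {K d : ℕ} {y : PiLp 2 (fun _ : Fin (K+1) => H)} {x : H}
    (h : EvConst 0 y x) (T : Fin d → H →L[ℂ] H) (p : MvPolynomial (Fin d) ℂ) :
    EvConst p.totalDegree (polyEval p (fun j => tshift K (T j)) y) (polyEval p T x) := by
  intro m hm
  simp only [polyEval, LinearMap.sum_apply, LinearMap.smul_apply, ContinuousLinearMap.sum_apply,
    ContinuousLinearMap.smul_apply, WithLp.ofLp_sum, Finset.sum_apply, PiLp.smul_apply]
  refine Finset.sum_congr rfl fun α hα => ?_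
  congr 1
  rw [List.ofFn_eq_map, List.ofFn_eq_map]
  refine h.list T α (List.finRange d) m ?_
  have h1 := MvPolynomial.le_totalDegree hα
  have h2 : ((List.finRange d).map α).sum = ∑ j, α j := by
    rw [← List.ofFn_eq_map, List.sum_ofFn]
  rw [Finsupp.sum_fintype _ _ (by simp)] at h1
  omega

end shift

theorem backward {d : ℕ} (p : MvPolynomial (Fin d) ℂ)
    (hp : ∀ (n : ℕ) (M : Fin d → Matrix (Fin n) (Fin n) ℂ),
        (∀ i j, Commute (M i) (M j)) → (∀ j, IsNilpotent (M j)) →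
        (∀ j, matOpNorm (M j) ≤ 1) → matOpNorm (polyEval p M) ≤ 1)
    {H : Type*} [NormedAddCommGroup H] [InnerProductSpace ℂ H] (T : Fin d → H →L[ℂ] H)
    (hc : ∀ i j, Commute (T i) (T j)) (h1 : ∀ j, ‖T j‖ ≤ 1) : ‖polyEval p T‖ ≤ 1 := by
  refine ContinuousLinearMap.opNorm_le_bound _ zero_le_one fun x => ?_
  rw [one_mul]
  refine le_of_sq_le_sq ?_ (norm_nonneg _)
  set D := p.totalDegree
  set a := ‖polyEval p T x‖ ^ 2
  set b := ‖x‖ ^ 2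
  have key : ∀ n : ℕ, ((n : ℝ) + 1) * a ≤ ((n : ℝ) + 1 + D) * b := by
    intro n
    let y : PiLp 2 (fun _ : Fin (D + n + 1) => H) := WithLp.toLp 2 (fun _ => x)
    have hy : EvConst 0 y x := fun m _ => rfl
    have h2 := nil_end p hp (fun j => tshift (D + n) (T j))
      (fun i j => tshift_comm _ _ _ (hc i j)) (fun j => tshift_nil _ _)
      (fun j => tshift_norm _ _ (h1 j)) y
    have h3 := hy.poly T p
    have h4 := pow_le_pow_left₀ (norm_nonneg _) h2 2
    rw [PiLp.norm_sq_eq_of_L2, PiLp.norm_sq_eq_of_L2] at h4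
    have h5 : ∑ i, ‖y i‖ ^ 2 = ((n : ℝ) + 1 + D) * b := by
      simp [y, b]; left; ring
    rw [h5] at h4
    refine le_trans ?_ h4
    have h6 : ∑ i : Fin (n + 1), ‖polyEval p (fun j => tshift (D + n) (T j)) y
        (Fin.natAdd D i)‖ ^ 2 = ((n : ℝ) + 1) * a := by
      rw [Finset.sum_congr rfl (g := fun _ => a)]
      · simp
      · intro i _
        rw [h3 (Fin.natAdd D i) (by simp [D])]
    rw [← h6]
    have h7 := Fin.sum_univ_add (a := D) (b := n + 1)
      (fun i => ‖polyEval p (fun j => tshift (D + n) (T j)) y i‖ ^ 2)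
    refine le_trans ?_ h7.ge
    exact le_add_of_nonneg_left (Finset.sum_nonneg fun i _ => sq_nonneg _)
  by_contra! hlt
  obtain ⟨n, hn⟩ := exists_nat_gt ((D * b) / (a - b))
  rw [div_lt_iff₀ (by linarith)] at hn
  nlinarith [key n]

theorem forward.{u} {d : ℕ} (p : MvPolynomial (Fin d) ℂ)
    (hp : ∀ (H : Type u) [NormedAddCommGroup H] [InnerProductSpace ℂ H] [CompleteSpace H]
        (T : Fin d → H →L[ℂ] H),
        (∀ i j, Commute (T i) (T j)) → (∀ j, ‖T j‖ ≤ 1) → ‖polyEval p T‖ ≤ 1)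
    (n : ℕ) (M : Fin d → Matrix (Fin n) (Fin n) ℂ)
    (hc : ∀ i j, Commute (M i) (M j)) (h1 : ∀ j, matOpNorm (M j) ≤ 1) :
    matOpNorm (polyEval p M) ≤ 1 := by
  let e : EuclideanSpace ℂ (Fin n) ≃ₗᵢ[ℂ] EuclideanSpace ℂ (ULift.{u} (Fin n)) :=
    LinearIsometryEquiv.piLpCongrLeft 2 ℂ ℂ Equiv.ulift.symm
  let φ := (Matrix.toEuclideanCLM (𝕜 := ℂ) (n := Fin n))
  let T : Fin d → EuclideanSpace ℂ (ULift.{u} (Fin n)) →L[ℂ] EuclideanSpace ℂ (ULift.{u} (Fin n)) :=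
    fun j => (e.toContinuousLinearEquiv : _ →L[ℂ] _) ∘L φ (M j) ∘L
      (e.symm.toContinuousLinearEquiv : _ →L[ℂ] _)
  have hT : ∀ j x, T j x = e (φ (M j) (e.symm x)) := fun j x => rfl
  have key := hp _ T ?_ ?_
  · rw [matOpNorm_eq, toCLM_polyEval]
    refine ContinuousLinearMap.opNorm_le_bound _ zero_le_one fun x => ?_
    have h2 := polyEval_intertwine p e.toLinearEquiv.toLinearMap
      (fun j => (φ (M j) : Module.End ℂ _)) (fun j => (T j : Module.End ℂ _))
      (fun j x => by simp [hT]) x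
    rw [← polyEval_clm, ← polyEval_clm] at h2
    rw [← e.norm_map, ← e.norm_map x]
    exact (congrArg norm h2).trans_le (ContinuousLinearMap.le_of_opNorm_le _ key _)
  · intro i j
    ext1 x
    have := congrArg (fun f => f (e.symm x)) ((hc i j).map φ).eq
    simp only [ContinuousLinearMap.mul_apply] at this
    simp only [ContinuousLinearMap.mul_apply, hT, e.symm_apply_apply, this]
  · intro j
    refine ContinuousLinearMap.opNorm_le_bound _ zero_le_one fun x => ?_
    rw [hT, e.norm_map, ← e.symm.norm_map x]
    have := h1 j
    rw [matOpNorm_eq] at this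
    exact ContinuousLinearMap.le_of_opNorm_le _ this _

/-- For a polynomial `p ∈ ℂ[z_1,…,z_d]`, the von Neumann inequality
`‖p(T)‖ ≤ 1` holds for every `d`-tuple of pairwise commuting contractive bounded operators
on a complex Hilbert space iff it holds for every `d`-tuple of pairwise commuting
contractive nilpotent complex square matrices. -/
theorem stmt0.{u} (d : ℕ) (p : MvPolynomial (Fin d) ℂ) :
    (∀ (H : Type u) [NormedAddCommGroup H] [InnerProductSpace ℂ H] [CompleteSpace H]
        (T : Fin d → H →L[ℂ] H),
        (∀ i j, Commute (T i) (T j)) → (∀ j, ‖T j‖ ≤ 1) → ‖polyEval p T‖ ≤ 1)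
    ↔
    (∀ (n : ℕ) (M : Fin d → Matrix (Fin n) (Fin n) ℂ),
        (∀ i j, Commute (M i) (M j)) → (∀ j, IsNilpotent (M j)) →
        (∀ j, matOpNorm (M j) ≤ 1) → matOpNorm (polyEval p M) ≤ 1) := by
  constructor
  · intro h n M hc _ h1
    exact forward p h n M hc h1
  · intro h H _ _ _ T hc h1
    exact backward p h T hc h1
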